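/- Let C be a free abelian group, let t > 1 be an integer, and let Ĉ_{t−1} = ℤ × ∏_{i=1}^{t−1} C^{⊗i} be the truncation of ℤ × ∏_{i=1}^∞ C^{⊗i} to tensor powers of order at most t − 1. For pairwise distinct, nonzero elements c₁, …, c_t of C, the t truncated elements (1, c_j, c_j ⊗ c_j, …, c_j^{⊗(t−1)}) ∈ Ĉ_{t−1}, for j = 1, …, t, become linearly independent over ℚ after applying ℚ ⊗_ℤ (−). In other words, already the tensor powers of order < t of distinct nonzero elements of C, together with the constant 1, are ℚ-linearly independent. -/

import Mathlib

open scoped TensorProduct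

/-- Finitely many distinct elements of a free abelian group are separated by a single additive
functional with values in `ℚ`. -/
theorem exists_linearMap_rat_comp_injective {C ι : Type*} [AddCommGroup C] [Module ℤ C]
    [Module.Free ℤ C] [Finite ι] (c : ι → C) (hc : Function.Injective c) :
    ∃ φ : C →ₗ[ℤ] ℚ, Function.Injective (φ ∘ c) := by
  let b := Module.Free.chooseBasis ℤ C
  let e : C →ₗ[ℤ] (Module.Free.ChooseBasisIndex ℤ C →₀ ℚ) :=
    Finsupp.mapRange.linearMap (Algebra.linearMap ℤ ℚ) ∘ₗ b.repr.toLinearMap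
  have he : Function.Injective e := by
    have h := Finsupp.mapRange_injective (α := Module.Free.ChooseBasisIndex ℤ C)
      (Algebra.linearMap ℤ ℚ) (map_zero _) Int.cast_injective
    exact h.comp b.repr.injective
  obtain ⟨f, hf⟩ := Module.exists_dual_forall_apply_ne_zero (K := ℚ)
    (fun p : {p : ι × ι // p.1 ≠ p.2} => e (c p.1.1) - e (c p.1.2))
    fun p => sub_ne_zero.mpr fun h => p.2 (hc (he h))
  refine ⟨f.restrictScalars ℤ ∘ₗ e, fun i j hij => ?_⟩
  by_contra hne
  refine hf ⟨(i, j), hne⟩ ?_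
  rw [map_sub, sub_eq_zero]
  exact hij

/-- The linear functional on the `n`-th tensor power induced by a linear map to a commutative
algebra, sending `x₁ ⊗ ⋯ ⊗ xₙ` to `φ x₁ * ⋯ * φ xₙ`; on diagonal tensors it is a power. -/
theorem exists_linearMap_tprod_const_eq_pow {R M A : Type*} [CommSemiring R] [AddCommMonoid M]
    [Module R M] [CommSemiring A] [Algebra R A] (φ : M →ₗ[R] A) (n : ℕ) :
    ∃ ψ : (⨂[R]^n M) →ₗ[R] A,
      ∀ x : M, ψ (PiTensorProduct.tprod R fun _ : Fin n => x) = φ x ^ n :=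
  ⟨PiTensorProduct.lift ((MultilinearMap.mkPiAlgebra R (Fin n) A).compLinearMap fun _ => φ),
    fun x => by simp⟩

/-- Lemma (truncated version): `C` a free abelian group, `t > 1`,
`Ĉ_{t-1} = ℤ × ∏_{i=1}^{t-1} C^{⊗i}`.  For pairwise distinct nonzero
`c₁,…,c_t ∈ C`, the truncated diagonal elements `(1, cⱼ, cⱼ⊗cⱼ, …, cⱼ^{⊗(t-1)})`
become linearly independent over `ℚ` after applying `ℚ ⊗_ℤ (−)`. -/
theorem truncated_diagonals_linearly_independent_rat
    (C : Type) [AddCommGroup C] [Module ℤ C] [Module.Free ℤ C]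
    (t : ℕ) (ht : 1 < t) (c : Fin t → C)
    (hdist : Function.Injective c) (hne : ∀ j, c j ≠ 0) :
    LinearIndependent ℚ (fun j : Fin t =>
      ((1 : ℚ) ⊗ₜ[ℤ]
        (((1 : ℤ), fun i : Fin (t - 1) =>
            (PiTensorProduct.tprod ℤ fun _ : Fin (i.1 + 1) => c j)) :
          ℤ × ((i : Fin (t - 1)) → ⨂[ℤ]^(i.1 + 1) C)) :
        ℚ ⊗[ℤ] (ℤ × ((i : Fin (t - 1)) → ⨂[ℤ]^(i.1 + 1) C)))) := by
  obtain ⟨φ, hφ⟩ := exists_linearMap_rat_comp_injective c hdist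
  rw [Fintype.linearIndependent_iff]
  intro g hg
  refine congrFun (Matrix.eq_zero_of_forall_pow_sum_mul_pow_eq_zero hφ fun i => ?_)
  suffices h : ∃ ψ : (ℤ × ((i : Fin (t - 1)) → ⨂[ℤ]^(i.1 + 1) C)) →ₗ[ℤ] ℚ,
      ∀ x : C, ψ (1, fun i => PiTensorProduct.tprod ℤ fun _ : Fin (i.1 + 1) => x) =
        φ x ^ (i : ℕ) by
    obtain ⟨ψ, hψ⟩ := h
    have := congrArg (ψ.liftBaseChange ℚ) hg
    simpa [hψ] using this
  obtain ⟨_ | k, hk⟩ := i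
  · exact ⟨Algebra.linearMap ℤ ℚ ∘ₗ LinearMap.fst ℤ _ _, fun x => by simp⟩
  · obtain ⟨ψ, hψ⟩ := exists_linearMap_tprod_const_eq_pow φ (k + 1)
    exact ⟨ψ ∘ₗ LinearMap.proj (⟨k, by omega⟩ : Fin (t - 1)) ∘ₗ LinearMap.snd ℤ _ _,
      fun x => hψ x⟩
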